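/- arXiv:0901.4665 — 6 statements merged into one kernel-verified Lean document; each statement's English description precedes it below -/
import Mathlib

section
/- Assume a ≠ 0 and b ≠ 0, and let f be (N−1) times continuously differentiable on [a,b]. Then there exist real polynomials q_a and q_b, each of degree at most N−1, such that ε_k = b^k q_b(k) − a^k q_a(k) for every k ∈ ℕ. -/
open Finset Polynomial

/-- The boundary ("bilinear concomitant") sequence
`ε_k = [ Σ_{j=1}^N Σ_{i=0}^{j−1} (−1)^i f^{(j−1−i)}(x) (d/dx)^i ( x^k p_j(x) ) ]_{x=a}^{x=b}`. -/
noncomputable def concomitantSeq (N : ℕ) (p : ℕ → Polynomial ℝ) (f : ℝ → ℝ)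
    (a b : ℝ) (k : ℕ) : ℝ :=
  (∑ j ∈ Finset.Icc 1 N, ∑ i ∈ Finset.range j,
      (-1 : ℝ) ^ i * iteratedDerivWithin (j - 1 - i) f (Set.Icc a b) b *
        ((fun q => Polynomial.derivative q)^[i] (Polynomial.X ^ k * p j)).eval b)
  - (∑ j ∈ Finset.Icc 1 N, ∑ i ∈ Finset.range j,
      (-1 : ℝ) ^ i * iteratedDerivWithin (j - 1 - i) f (Set.Icc a b) a *
        ((fun q => Polynomial.derivative q)^[i] (Polynomial.X ^ k * p j)).eval a)

theorem exists_eval_iterate_derivative_X_pow_mul (x : ℝ) (hx : x ≠ 0) (p : ℝ[X]) (i : ℕ) :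
    ∃ q ∈ degreeLE ℝ (i : ℕ), ∀ k : ℕ,
      ((fun q => derivative q)^[i] (X ^ k * p)).eval x = x ^ k * q.eval (k : ℝ) := by
  refine ⟨∑ m ∈ range (i + 1), (i.choose m * x⁻¹ ^ (i - m) * (derivative^[m] p).eval x) •
    descPochhammer ℝ (i - m), ?_, fun k => ?_⟩
  · refine Submodule.sum_mem _ fun m _ => Submodule.smul_mem _ _ ?_
    rw [mem_degreeLE]
    refine degree_le_of_natDegree_le ?_
    rw [descPochhammer_natDegree]
    exact Nat.sub_le _ _
  · change (derivative^[i] (X ^ k * p)).eval x = _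
    rw [iterate_derivative_mul, eval_finsetSum, eval_finsetSum, mul_sum]
    refine sum_congr rfl fun m _ => ?_
    simp only [iterate_derivative_X_pow_eq_smul, eval_smul, eval_mul, eval_pow, eval_X,
      smul_eq_mul, nsmul_eq_mul, eval_natCast,
      descPochhammer_eval_eq_descFactorial]
    rcases le_or_gt (i - m) k with h | h
    · rw [inv_pow, pow_sub₀ x hx h]
      ring
    · simp [Nat.descFactorial_of_lt h]

theorem exists_boundary_sum_eq (x : ℝ) (hx : x ≠ 0) (N : ℕ) (p : ℕ → ℝ[X]) (c : ℕ → ℕ → ℝ) :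
    ∃ q : ℝ[X], q.degree ≤ (N - 1 : ℕ) ∧ ∀ k : ℕ,
      ∑ j ∈ Icc 1 N, ∑ i ∈ range j,
        c j i * ((fun q => derivative q)^[i] (X ^ k * p j)).eval x = x ^ k * q.eval (k : ℝ) := by
  choose q hq hqk using fun j => exists_eval_iterate_derivative_X_pow_mul x hx (p j)
  refine ⟨∑ j ∈ Icc 1 N, ∑ i ∈ range j, c j i • q j i, ?_, fun k => ?_⟩
  · rw [← mem_degreeLE]
    refine Submodule.sum_mem _ fun j hj => Submodule.sum_mem _ fun i hi =>
      Submodule.smul_mem _ _ (degreeLE_mono ?_ (hq j i))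
    rw [mem_Icc] at hj
    rw [mem_range] at hi
    exact_mod_cast (by omega : i ≤ N - 1)
  · simp only [hqk, eval_finsetSum, eval_smul, smul_eq_mul, mul_sum]
    exact sum_congr rfl fun j _ => sum_congr rfl fun i _ => by ring

theorem concomitant_structure (a b : ℝ) (hab : a < b) (ha : a ≠ 0) (hb : b ≠ 0)
    (N : ℕ) (hN : 1 ≤ N) (p : ℕ → Polynomial ℝ) (f : ℝ → ℝ)
    (hf : ContDiffOn ℝ (N - 1 : ℕ) f (Set.Icc a b)) :
    ∃ qa qb : Polynomial ℝ, qa.degree ≤ (N - 1 : ℕ) ∧ qb.degree ≤ (N - 1 : ℕ) ∧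
      ∀ k : ℕ, concomitantSeq N p f a b k
        = b ^ k * qb.eval (k : ℝ) - a ^ k * qa.eval (k : ℝ) := by
  obtain ⟨qa, hqa, hqak⟩ := exists_boundary_sum_eq a ha N p
    fun j i => (-1 : ℝ) ^ i * iteratedDerivWithin (j - 1 - i) f (Set.Icc a b) a
  obtain ⟨qb, hqb, hqbk⟩ := exists_boundary_sum_eq b hb N p
    fun j i => (-1 : ℝ) ^ i * iteratedDerivWithin (j - 1 - i) f (Set.Icc a b) b
  refine ⟨qa, qb, hqa, hqb, fun k => ?_⟩
  rw [concomitantSeq, hqak, hqbk]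
end

section
/- Assume a ≠ 0 and b ≠ 0, let f be N times continuously differentiable on [a,b] with Σ_{j=0}^N p_j(x) f^{(j)}(x) = 0 for all x ∈ [a,b], and assume the leading coefficient satisfies p_N(x) ≠ 0 for all x ∈ [a,b]. Then ε_k = 0 for every k ∈ ℕ if and only if f is identically zero on [a,b]. -/
open Finset Polynomial

theorem eval_iterate_derivative_X_sub_C_pow_mul_of_lt (c : ℝ) {m i : ℕ} (h : i < m)
    (g : Polynomial ℝ) : (derivative^[i] ((X - C c) ^ m * g)).eval c = 0 := by
  obtain ⟨r, hr⟩ := pow_sub_dvd_iterate_derivative_of_pow_dvd i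
    (Dvd.intro g rfl : (X - C c) ^ m ∣ (X - C c) ^ m * g)
  rw [hr]
  simp [Nat.sub_ne_zero_of_lt h]

theorem eval_iterate_derivative_X_sub_C_pow_mul_self (c : ℝ) (m : ℕ) (g : Polynomial ℝ) :
    (derivative^[m] ((X - C c) ^ m * g)).eval c = m.factorial * g.eval c := by
  induction m generalizing g with
  | zero => simp
  | succ m ih =>
    have h : derivative ((X - C c) ^ (m + 1) * g)
        = (X - C c) ^ m * (C ((m : ℝ) + 1) * g + (X - C c) * derivative g) := by
      rw [derivative_mul, derivative_X_sub_C_pow]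
      simp only [Nat.add_sub_cancel, Nat.cast_add, Nat.cast_one, map_add, map_one, map_natCast]
      ring
    rw [Function.iterate_succ_apply, h, ih]
    simp [Nat.factorial_succ]
    ring

/-- The bilinear concomitant at a point `x`, with the derivatives of the first argument replaced by
arbitrary data `u`. -/
noncomputable def concomitantAt (N : ℕ) (p : ℕ → Polynomial ℝ) (u : ℕ → ℝ) (x : ℝ)
    (q : Polynomial ℝ) : ℝ :=
  ∑ j ∈ Finset.Icc 1 N, ∑ i ∈ Finset.range j,
    (-1 : ℝ) ^ i * u (j - 1 - i) * (derivative^[i] (q * p j)).eval x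

theorem concomitantAt_add (N : ℕ) (p : ℕ → Polynomial ℝ) (u : ℕ → ℝ) (x : ℝ)
    (q r : Polynomial ℝ) :
    concomitantAt N p u x (q + r) = concomitantAt N p u x q + concomitantAt N p u x r := by
  simp only [concomitantAt, add_mul, iterate_map_add, eval_add, mul_add,
    Finset.sum_add_distrib]

theorem concomitantAt_C_mul (N : ℕ) (p : ℕ → Polynomial ℝ) (u : ℕ → ℝ) (x c : ℝ)
    (q : Polynomial ℝ) :
    concomitantAt N p u x (C c * q) = c * concomitantAt N p u x q := by
  simp only [concomitantAt, mul_assoc, iterate_derivative_C_mul, eval_mul, eval_C,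
    Finset.mul_sum]
  refine Finset.sum_congr rfl fun j _ => Finset.sum_congr rfl fun i _ => ?_
  ring

theorem concomitantAt_eq_of_X_pow {N : ℕ} {p : ℕ → Polynomial ℝ} {u v : ℕ → ℝ} {x y : ℝ}
    (h : ∀ k : ℕ, concomitantAt N p u x (X ^ k) = concomitantAt N p v y (X ^ k))
    (q : Polynomial ℝ) : concomitantAt N p u x q = concomitantAt N p v y q := by
  induction q using Polynomial.induction_on' with
  | add q r hq hr => rw [concomitantAt_add, concomitantAt_add, hq, hr]
  | monomial n c =>
    rw [← C_mul_X_pow_eq_monomial, concomitantAt_C_mul, concomitantAt_C_mul, h]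

theorem concomitantAt_X_sub_C_pow_mul (N : ℕ) (p : ℕ → Polynomial ℝ) (u : ℕ → ℝ) (x : ℝ)
    (r : Polynomial ℝ) : concomitantAt N p u x ((X - C x) ^ N * r) = 0 := by
  refine Finset.sum_eq_zero fun j hj => Finset.sum_eq_zero fun i hi => ?_
  rw [Finset.mem_Icc] at hj
  rw [Finset.mem_range] at hi
  rw [mul_assoc _ r, eval_iterate_derivative_X_sub_C_pow_mul_of_lt x (by omega), mul_zero]

theorem concomitantAt_eq_single {N l : ℕ} (hl : l < N) (p : ℕ → Polynomial ℝ) {u : ℕ → ℝ}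
    (hu : ∀ n < l, u n = 0) (x : ℝ) (r : Polynomial ℝ) :
    concomitantAt N p u x ((X - C x) ^ (N - 1 - l) * r) =
      (-1) ^ (N - 1 - l) * u l * ((N - 1 - l).factorial * (r.eval x * (p N).eval x)) := by
  have key : ∀ j ∈ Finset.Icc 1 N, ∀ i ∈ Finset.range j, ¬ (j = N ∧ i = N - 1 - l) →
      (-1 : ℝ) ^ i * u (j - 1 - i) *
        (derivative^[i] ((X - C x) ^ (N - 1 - l) * r * p j)).eval x = 0 := by
    intro j hj i hi hne
    rw [Finset.mem_Icc] at hj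
    rw [Finset.mem_range] at hi
    rcases lt_or_ge i (N - 1 - l) with h | h
    · rw [mul_assoc _ r, eval_iterate_derivative_X_sub_C_pow_mul_of_lt x h, mul_zero]
    · rw [hu (j - 1 - i) (by omega), mul_zero, zero_mul]
  rw [concomitantAt, Finset.sum_eq_single N, Finset.sum_eq_single (N - 1 - l)]
  · rw [mul_assoc _ r, eval_iterate_derivative_X_sub_C_pow_mul_self, eval_mul,
      show N - 1 - (N - 1 - l) = l by omega]
  · exact fun i hi hne => key N (Finset.mem_Icc.2 ⟨by omega, le_rfl⟩) i hi fun h => hne h.2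
  · intro h
    rw [Finset.mem_range] at h
    omega
  · exact fun j hj hne => Finset.sum_eq_zero fun i hi => key j hj i hi fun h => hne h.1
  · intro h
    rw [Finset.mem_Icc] at h
    omega

theorem eq_zero_of_concomitantAt_eq {N : ℕ} {p : ℕ → Polynomial ℝ} {u v : ℕ → ℝ} {x y : ℝ}
    (hxy : x ≠ y) (hp : (p N).eval x ≠ 0)
    (h : ∀ q, concomitantAt N p u x q = concomitantAt N p v y q) :
    ∀ l < N, u l = 0 := by
  intro l
  induction l using Nat.strong_induction_on with
  | _ l ih =>
    intro hl
    have hq := h ((X - C x) ^ (N - 1 - l) * (X - C y) ^ N)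
    rw [concomitantAt_eq_single hl p (fun n hn => ih n hn (hn.trans hl)),
      mul_comm ((X - C x) ^ (N - 1 - l)), concomitantAt_X_sub_C_pow_mul] at hq
    have hxy' : x - y ≠ 0 := sub_ne_zero.2 hxy
    simpa [hp, hxy', Nat.factorial_ne_zero] using hq

/-- Uniqueness for a linear homogeneous equation of order `N` with vanishing initial data at the
left endpoint. -/
theorem eq_zero_of_linear_ode {a b : ℝ} (hab : a < b) {N : ℕ} (hN : 1 ≤ N)
    {p : ℕ → ℝ → ℝ} (hp : ∀ j, ContinuousOn (p j) (Set.Icc a b)) {f : ℝ → ℝ}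
    (hf : ContDiffOn ℝ (N : ℕ) f (Set.Icc a b))
    (hode : ∀ x ∈ Set.Icc a b,
      ∑ j ∈ Finset.range (N + 1), p j x * iteratedDerivWithin j f (Set.Icc a b) x = 0)
    (hlead : ∀ x ∈ Set.Icc a b, p N x ≠ 0)
    (hinit : ∀ l < N, iteratedDerivWithin l f (Set.Icc a b) a = 0) :
    ∀ x ∈ Set.Icc a b, f x = 0 := by
  have hcont : ContinuousOn (fun x => ∑ j ∈ Finset.range N, |p j x / p N x|) (Set.Icc a b) :=
    continuousOn_finsetSum _ fun j _ => ((hp j).div (hp N) hlead).abs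
  obtain ⟨M, hM⟩ := isCompact_Icc.bddAbove_image hcont
  set y : ℝ → Fin N → ℝ := fun x i => iteratedDerivWithin i f (Set.Icc a b) x with hy
  have hyle : ∀ x, ∀ j < N, |iteratedDerivWithin j f (Set.Icc a b) x| ≤ ‖y x‖ :=
    fun x j hj => norm_le_pi_norm (y x) ⟨j, hj⟩
  have hzero : ∀ x ∈ Set.Icc a b, y x = 0 := by
    refine eq_zero_of_abs_deriv_le_mul_abs_self_of_eq_zero_right
      (f' := fun x (i : Fin N) => iteratedDerivWithin (i + 1) f (Set.Icc a b) x)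
      (K := max 1 M) ?_ ?_ ?_ ?_
    · exact continuousOn_pi.2 fun i => hf.continuousOn_iteratedDerivWithin
        (by exact_mod_cast i.2.le) (uniqueDiffOn_Icc hab)
    · intro x hx
      refine hasDerivWithinAt_pi.2 fun i => ?_
      have hd := (hf.differentiableOn_iteratedDerivWithin (m := i) (by exact_mod_cast i.2)
        (uniqueDiffOn_Icc hab) x (Set.Ico_subset_Icc_self hx)).hasDerivWithinAt
      rw [← iteratedDerivWithin_succ] at hd
      exact hd.mono_of_mem_nhdsWithin (Icc_mem_nhdsGE_of_mem hx)
    · exact funext fun i => hinit i i.2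
    · intro x hx
      have hx' := Set.Ico_subset_Icc_self hx
      refine (pi_norm_le_iff_of_nonneg (by positivity)).2 fun i => ?_
      rw [Real.norm_eq_abs]
      rcases Nat.lt_or_ge (i + 1) N with hi | hi
      · exact (hyle x _ hi).trans (le_mul_of_one_le_left (norm_nonneg _) (le_max_left _ _))
      · have hiN : (i : ℕ) + 1 = N := by omega
        have hsolve : iteratedDerivWithin N f (Set.Icc a b) x =
            -∑ j ∈ Finset.range N, p j x / p N x * iteratedDerivWithin j f (Set.Icc a b) x := by
          have h := hode x hx'
          have h0 := hlead x hx'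
          rw [Finset.sum_range_succ] at h
          simp only [div_mul_eq_mul_div]
          rw [← Finset.sum_div]
          field_simp
          linarith
        rw [hiN, hsolve, abs_neg]
        calc _ ≤ ∑ j ∈ Finset.range N, |p j x / p N x * iteratedDerivWithin j f (Set.Icc a b) x| :=
              Finset.abs_sum_le_sum_abs _ _
          _ ≤ ∑ j ∈ Finset.range N, |p j x / p N x| * ‖y x‖ := by
              refine Finset.sum_le_sum fun j hj => ?_
              rw [abs_mul]
              exact mul_le_mul_of_nonneg_left (hyle x j (Finset.mem_range.1 hj)) (abs_nonneg _)
          _ = (∑ j ∈ Finset.range N, |p j x / p N x|) * ‖y x‖ := (Finset.sum_mul _ _ _).symm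
          _ ≤ max 1 M * ‖y x‖ := mul_le_mul_of_nonneg_right
              ((hM (Set.mem_image_of_mem _ hx')).trans (le_max_right _ _)) (norm_nonneg _)
  intro x hx
  simpa [hy] using congrFun (hzero x hx) ⟨0, hN⟩

theorem concomitant_vanishing_iff (a b : ℝ) (hab : a < b) (ha : a ≠ 0) (hb : b ≠ 0)
    (N : ℕ) (hN : 1 ≤ N) (p : ℕ → Polynomial ℝ) (f : ℝ → ℝ)
    (hf : ContDiffOn ℝ (N : ℕ) f (Set.Icc a b))
    (hode : ∀ x ∈ Set.Icc a b,
      ∑ j ∈ Finset.range (N + 1),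
        (p j).eval x * iteratedDerivWithin j f (Set.Icc a b) x = 0)
    (hlead : ∀ x ∈ Set.Icc a b, (p N).eval x ≠ 0) :
    (∀ k : ℕ, concomitantSeq N p f a b k = 0) ↔ (∀ x ∈ Set.Icc a b, f x = 0) := by
  have hseq : ∀ k, concomitantSeq N p f a b k =
      concomitantAt N p (fun n => iteratedDerivWithin n f (Set.Icc a b) b) b (X ^ k) -
      concomitantAt N p (fun n => iteratedDerivWithin n f (Set.Icc a b) a) a (X ^ k) :=
    fun k => rfl
  constructor
  · intro h
    have hX : ∀ k : ℕ,
        concomitantAt N p (fun n => iteratedDerivWithin n f (Set.Icc a b) a) a (X ^ k) =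
        concomitantAt N p (fun n => iteratedDerivWithin n f (Set.Icc a b) b) b (X ^ k) :=
      fun k => (sub_eq_zero.1 ((hseq k).symm.trans (h k))).symm
    exact eq_zero_of_linear_ode hab hN (p := fun j x => (p j).eval x)
      (fun j => (p j).continuous.continuousOn) hf hode hlead
      (eq_zero_of_concomitantAt_eq hab.ne (hlead a (Set.left_mem_Icc.2 hab.le))
        (concomitantAt_eq_of_X_pow hX))
  · intro h k
    have hz : ∀ n, ∀ x ∈ Set.Icc a b, iteratedDerivWithin n f (Set.Icc a b) x = 0 := by
      intro n x hx
      rw [iteratedDerivWithin_congr (g := fun _ => (0 : ℝ)) (fun y hy => h y hy) hx]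
      simp
    simp [concomitantSeq, hz _ a (Set.left_mem_Icc.2 hab.le), hz _ b (Set.right_mem_Icc.2 hab.le)]
end

section
/- Let f be N times continuously differentiable on [a,b] with Σ_{j=0}^N p_j(x) f^{(j)}(x) = 0 for all x ∈ [a,b]. Then the moment sequence of f satisfies, for every k ∈ ℕ, the recurrence Σ_{r=0}^N Σ_{s=0}^N binom(N,r) binom(N,s) (−a)^{N−r} (−b)^{N−s} Σ_{j=0}^N Σ_{i=0}^{d_j} a_{i,j} (−1)^j (i+k+r+s)_j · m_{k+r+s+i−j} = 0. -/
open Finset intervalIntegral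

/-- The falling factorial `(x)_j = x(x−1)⋯(x−j+1)`, with `(x)_0 = 1`. -/
noncomputable def fallingFactorial (x : ℝ) (j : ℕ) : ℝ :=
  ∏ l ∈ Finset.range j, (x - l)

section MomentFunctional

open Polynomial MeasureTheory

theorem fallingFactorial_natCast (n j : ℕ) :
    fallingFactorial (n : ℝ) j = n.descFactorial j := by
  rw [← descPochhammer_eval_eq_descFactorial, descPochhammer_eval_eq_prod_range]
  rfl

/-- The linear functional sending a polynomial `P` to `∫ x in a..b, P(x) f(x)`. -/
noncomputable def momentFunctional {a b : ℝ} {f : ℝ → ℝ}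
    (hf : IntervalIntegrable f volume a b) : ℝ[X] →ₗ[ℝ] ℝ where
  toFun P := ∫ x in a..b, P.eval x * f x
  map_add' P Q := by
    rw [← intervalIntegral.integral_add (hf.continuousOn_mul P.continuous.continuousOn)
      (hf.continuousOn_mul Q.continuous.continuousOn)]
    simp only [eval_add, add_mul]
  map_smul' c P := by
    simp only [eval_smul, smul_eq_mul, mul_assoc, RingHom.id_apply,
      intervalIntegral.integral_const_mul]

theorem momentFunctional_apply {a b : ℝ} {f : ℝ → ℝ}
    (hf : IntervalIntegrable f volume a b) (P : ℝ[X]) :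
    momentFunctional hf P = ∫ x in a..b, P.eval x * f x := rfl

theorem momentFunctional_iterate_derivative_X_pow {a b : ℝ} {f : ℝ → ℝ}
    (hf : IntervalIntegrable f volume a b) {m : ℤ → ℝ}
    (hm : ∀ k : ℕ, m k = ∫ x in a..b, x ^ k * f x) (n j : ℕ) :
    momentFunctional hf (derivative^[j] (X ^ n)) =
      fallingFactorial (n : ℝ) j * m ((n : ℤ) - j) := by
  rw [iterate_derivative_X_pow_eq_smul, map_smul, smul_eq_mul, fallingFactorial_natCast]
  rcases lt_or_ge n j with h | h
  · simp [Nat.descFactorial_eq_zero_iff_lt.mpr h]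
  · rw [← Nat.cast_sub h, hm, momentFunctional_apply]
    simp

/-- Repeated integration by parts against a polynomial that vanishes to order `j` at both
endpoints. -/
theorem integral_eval_mul_iteratedDerivWithin {a b : ℝ} (hab : a < b) {f : ℝ → ℝ} {N : ℕ}
    (hf : ContDiffOn ℝ N f (Set.Icc a b)) {j : ℕ} (hj : j ≤ N) (Q : ℝ[X])
    (ha : (X - C a) ^ j ∣ Q) (hb : (X - C b) ^ j ∣ Q) :
    ∫ x in a..b, Q.eval x * iteratedDerivWithin j f (Set.Icc a b) x =
      (-1) ^ j * ∫ x in a..b, (derivative^[j] Q).eval x * f x := by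
  induction j generalizing Q with
  | zero => simp
  | succ j ih =>
    have hs := uniqueDiffOn_Icc hab
    have hcont : ∀ i ≤ N, ContinuousOn (iteratedDerivWithin i f (Set.Icc a b)) (Set.uIcc a b) := by
      intro i hi
      rw [Set.uIcc_of_le hab.le]
      exact hf.continuousOn_iteratedDerivWithin (mod_cast hi) hs
    have hderiv : ∀ x ∈ Set.uIcc a b, HasDerivWithinAt (iteratedDerivWithin j f (Set.Icc a b))
        (iteratedDerivWithin (j + 1) f (Set.Icc a b) x) (Set.uIcc a b) x := by
      intro x hx
      rw [Set.uIcc_of_le hab.le] at hx ⊢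
      rw [iteratedDerivWithin_succ]
      exact (hf.differentiableOn_iteratedDerivWithin (mod_cast hj) hs x hx).hasDerivWithinAt
    have hQa : Q.eval a = 0 := dvd_iff_isRoot.mp ((dvd_pow_self _ j.succ_ne_zero).trans ha)
    have hQb : Q.eval b = 0 := dvd_iff_isRoot.mp ((dvd_pow_self _ j.succ_ne_zero).trans hb)
    have hda : (X - C a) ^ j ∣ derivative Q := by
      simpa using pow_sub_dvd_iterate_derivative_of_pow_dvd 1 ha
    have hdb : (X - C b) ^ j ∣ derivative Q := by
      simpa using pow_sub_dvd_iterate_derivative_of_pow_dvd 1 hb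
    rw [integral_mul_deriv_eq_deriv_mul_of_hasDerivWithinAt
      (fun x _ ↦ (Q.hasDerivAt x).hasDerivWithinAt) hderiv
      (Q.derivative.continuous.intervalIntegrable a b) (hcont _ hj).intervalIntegrable,
      ih (Nat.le_of_succ_le hj) _ hda hdb, hQa, hQb, Function.iterate_succ_apply]
    ring

/-- The sum `∑ j, (-1) ^ j • L ((P * p j)⁽ʲ⁾)`: the functional `L` composed with the formal adjoint
of the differential operator `∑ j, p j ∂ʲ`. -/
noncomputable def adjointFunctional (L : ℝ[X] →ₗ[ℝ] ℝ) (p : ℕ → ℝ[X]) (N : ℕ) :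
    ℝ[X] →ₗ[ℝ] ℝ :=
  ∑ j ∈ Finset.range (N + 1),
    (-1 : ℝ) ^ j • (L ∘ₗ (derivative ^ j) ∘ₗ LinearMap.mulRight ℝ (p j))

theorem adjointFunctional_apply (L : ℝ[X] →ₗ[ℝ] ℝ) (p : ℕ → ℝ[X]) (N : ℕ) (P : ℝ[X]) :
    adjointFunctional L p N P =
      ∑ j ∈ Finset.range (N + 1), (-1) ^ j * L (derivative^[j] (P * p j)) := by
  simp [adjointFunctional, LinearMap.sum_apply, Module.End.pow_apply]

theorem adjointFunctional_momentFunctional_eq_zero {a b : ℝ} (hab : a < b) {f : ℝ → ℝ} {N : ℕ}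
    (hf : ContDiffOn ℝ N f (Set.Icc a b)) (hint : IntervalIntegrable f volume a b)
    {p : ℕ → ℝ[X]}
    (hode : ∀ x ∈ Set.Icc a b, ∑ j ∈ Finset.range (N + 1),
      (p j).eval x * iteratedDerivWithin j f (Set.Icc a b) x = 0)
    {Q : ℝ[X]} (ha : (X - C a) ^ N ∣ Q) (hb : (X - C b) ^ N ∣ Q) :
    adjointFunctional (momentFunctional hint) p N Q = 0 := by
  rw [adjointFunctional_apply]
  have hparts : ∀ j ∈ Finset.range (N + 1),
      (-1) ^ j * momentFunctional hint (derivative^[j] (Q * p j)) =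
        ∫ x in a..b, (Q * p j).eval x * iteratedDerivWithin j f (Set.Icc a b) x := by
    intro j hj
    have hj' : j ≤ N := Nat.lt_succ_iff.mp (Finset.mem_range.mp hj)
    rw [momentFunctional_apply, integral_eval_mul_iteratedDerivWithin hab hf hj' _
      (((pow_dvd_pow _ hj').trans ha).mul_right _) (((pow_dvd_pow _ hj').trans hb).mul_right _)]
  rw [Finset.sum_congr rfl hparts, ← intervalIntegral.integral_finsetSum]
  · rw [intervalIntegral.integral_congr (g := fun _ ↦ 0), intervalIntegral.integral_zero]
    intro x hx
    rw [Set.uIcc_of_le hab.le] at hx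
    simp only [eval_mul, mul_assoc, ← Finset.mul_sum, hode x hx, mul_zero]
  · intro j hj
    have hj' : j ≤ N := Nat.lt_succ_iff.mp (Finset.mem_range.mp hj)
    refine ContinuousOn.intervalIntegrable ?_
    rw [Set.uIcc_of_le hab.le]
    exact (Q * p j).continuous.continuousOn.mul
      (hf.continuousOn_iteratedDerivWithin (mod_cast hj') (uniqueDiffOn_Icc hab))

theorem X_pow_mul_X_sub_C_pow_mul_X_sub_C_pow (a b : ℝ) (N k : ℕ) :
    (X ^ k * (X - C a) ^ N * (X - C b) ^ N : ℝ[X]) =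
      ∑ r ∈ Finset.range (N + 1), ∑ s ∈ Finset.range (N + 1),
        ((N.choose r : ℝ) * (N.choose s : ℝ) * (-a) ^ (N - r) * (-b) ^ (N - s)) •
          X ^ (k + r + s) := by
  rw [mul_assoc, sub_eq_add_neg, sub_eq_add_neg, ← C_neg, ← C_neg, add_pow, add_pow,
    Finset.sum_mul_sum, Finset.mul_sum]
  refine Finset.sum_congr rfl fun r _ ↦ ?_
  rw [Finset.mul_sum]
  refine Finset.sum_congr rfl fun s _ ↦ ?_
  simp only [smul_eq_C_mul, C_mul, C_pow, ← C_eq_natCast]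
  ring

end MomentFunctional

theorem moment_recurrence (a b : ℝ) (hab : a < b) (N : ℕ) (hN : 1 ≤ N)
    (d : ℕ → ℕ) (A : ℕ → ℕ → ℝ) (f : ℝ → ℝ)
    (hf : ContDiffOn ℝ (N : ℕ) f (Set.Icc a b))
    (hode : ∀ x ∈ Set.Icc a b,
      ∑ j ∈ Finset.range (N + 1),
        (∑ i ∈ Finset.range (d j + 1), A i j * x ^ i) *
          iteratedDerivWithin j f (Set.Icc a b) x = 0)
    (m : ℤ → ℝ)
    (hm : ∀ k : ℕ, m k = ∫ x in a..b, x ^ k * f x)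
    (hm0 : ∀ k : ℤ, k < 0 → m k = 0) :
    ∀ k : ℕ, ∑ r ∈ Finset.range (N + 1), ∑ s ∈ Finset.range (N + 1),
      (N.choose r : ℝ) * (N.choose s : ℝ) * (-a) ^ (N - r) * (-b) ^ (N - s) *
        ∑ j ∈ Finset.range (N + 1), ∑ i ∈ Finset.range (d j + 1),
          A i j * (-1) ^ j * fallingFactorial ((i : ℝ) + k + r + s) j *
            m ((k : ℤ) + r + s + i - j) = 0 := by
  intro k
  have hint : IntervalIntegrable f MeasureTheory.volume a b :=
    ContinuousOn.intervalIntegrable (by rw [Set.uIcc_of_le hab.le]; exact hf.continuousOn)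
  let p : ℕ → Polynomial ℝ := fun j ↦
    ∑ i ∈ Finset.range (d j + 1), A i j • Polynomial.X ^ i
  have hzero := adjointFunctional_momentFunctional_eq_zero hab hf hint (p := p)
    (by simpa [p, Polynomial.eval_finsetSum] using hode)
    (Q := Polynomial.X ^ k * (Polynomial.X - Polynomial.C a) ^ N *
      (Polynomial.X - Polynomial.C b) ^ N)
    ((dvd_mul_left _ _).mul_right _) (dvd_mul_left _ _)
  rw [X_pow_mul_X_sub_C_pow_mul_X_sub_C_pow] at hzero
  simp only [map_sum, map_smul, smul_eq_mul] at hzero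
  rw [← hzero]
  refine Finset.sum_congr rfl fun r _ ↦ Finset.sum_congr rfl fun s _ ↦ ?_
  congr 1
  rw [adjointFunctional_apply]
  refine Finset.sum_congr rfl fun j _ ↦ ?_
  simp only [p, Finset.mul_sum, mul_smul_comm, ← pow_add, Polynomial.iterate_derivative_sum,
    Polynomial.iterate_derivative_smul, map_sum, map_smul, smul_eq_mul,
    momentFunctional_iterate_derivative_X_pow hint hm]
  refine Finset.sum_congr rfl fun i _ ↦ ?_
  push_cast
  rw [show (i : ℝ) + k + r + s = k + r + s + i by ring]
  ring
end

section
/- Let ξ_1 < ⋯ < ξ_p be points of the open interval (a,b), set ξ_0 = a and ξ_{p+1} = b, and let ρ(x) = ∏_{i=1}^p (x − ξ_i)^N. Suppose f : [a,b] → ℝ coincides on each interval [ξ_n, ξ_{n+1}) with a function f_n that is N times continuously differentiable on [ξ_n, ξ_{n+1}] and satisfies Σ_{j=0}^N p_j(x) f_n^{(j)}(x) = 0 for all x ∈ [ξ_n, ξ_{n+1}]. Then the operator ρ(x)·Op annihilates f as a distribution on (a,b): for every infinitely differentiable function φ : ℝ → ℝ with compact support contained in (a,b), ∫_a^b f(x)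 · Σ_{j=0}^N (−1)^j (d/dx)^j ( ρ(x) p_j(x) φ(x) ) dx = 0. -/
open Finset intervalIntegral Polynomial

/-- The product of `(y - c) ^ n` with a smooth function vanishes at `c` to order `n`. -/
theorem iteratedDeriv_sub_pow_mul_eq_zero (c : ℝ) {k n : ℕ} (hkn : k < n) {h : ℝ → ℝ}
    (hh : ContDiff ℝ (⊤ : ℕ∞) h) : iteratedDeriv k (fun y => (y - c) ^ n * h y) c = 0 := by
  induction k generalizing n h with
  | zero => simp [show n ≠ 0 by lia]
  | succ k ih =>
    obtain ⟨m, rfl⟩ : ∃ m, n = m + 1 := ⟨n - 1, by lia⟩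
    obtain ⟨hd, hd'⟩ := contDiff_infty_iff_deriv.mp hh
    have hderiv : deriv (fun y => (y - c) ^ (m + 1) * h y) =
        fun y => (y - c) ^ m * (((m : ℝ) + 1) * h y + (y - c) * deriv h y) := by
      funext y
      refine HasDerivAt.deriv
        (((((hasDerivAt_id y).sub_const c).pow (m + 1)).mul (hd y).hasDerivAt).congr_deriv ?_)
      simp
      ring
    rw [iteratedDeriv_succ', hderiv]
    exact ih (by lia)
      ((contDiff_const.mul hh).add ((contDiff_id.sub contDiff_const).mul hd'))

/-- Repeated integration by parts against a smooth function whose derivatives of order `< j`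
vanish at both endpoints. -/
theorem integral_mul_iteratedDeriv_of_vanishing {u v : ℝ} (huv : u < v) (j : ℕ) {F g : ℝ → ℝ}
    (hF : ContDiffOn ℝ j F (Set.Icc u v)) (hg : ContDiff ℝ (⊤ : ℕ∞) g)
    (hu : ∀ k < j, iteratedDeriv k g u = 0) (hv : ∀ k < j, iteratedDeriv k g v = 0) :
    ∫ x in u..v, F x * iteratedDeriv j g x =
      (-1) ^ j * ∫ x in u..v, iteratedDerivWithin j F (Set.Icc u v) x * g x := by
  induction j generalizing g with
  | zero => simp
  | succ j ih =>
    have hI : UniqueDiffOn ℝ (Set.Icc u v) := uniqueDiffOn_Icc huv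
    obtain ⟨hd, hd'⟩ := contDiff_infty_iff_deriv.mp hg
    have hcont := hF.continuousOn_iteratedDerivWithin le_rfl hI
    have hdiff : DifferentiableOn ℝ (iteratedDerivWithin j F (Set.Icc u v)) (Set.Icc u v) :=
      hF.differentiableOn_iteratedDerivWithin (by exact_mod_cast j.lt_succ_self) hI
    have hparts : ∫ x in u..v, iteratedDerivWithin j F (Set.Icc u v) x * deriv g x =
        -∫ x in u..v, iteratedDerivWithin (j + 1) F (Set.Icc u v) x * g x := by
      have hgu : g u = 0 := by simpa using hu 0 j.succ_pos
      have hgv : g v = 0 := by simpa using hv 0 j.succ_pos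
      rw [← Set.uIcc_of_le huv.le] at hdiff hcont ⊢
      rw [integral_mul_deriv_eq_deriv_mul_of_hasDerivWithinAt
        (u' := iteratedDerivWithin (j + 1) F (Set.uIcc u v)) (v := g) ?_
        (fun x _ => (hd x).hasDerivAt.hasDerivWithinAt) hcont.intervalIntegrable
        (hd'.continuous.intervalIntegrable u v), hgu, hgv]
      · simp
      · intro x hx
        rw [iteratedDerivWithin_succ]
        exact (hdiff x hx).hasDerivWithinAt
    rw [iteratedDeriv_succ', ih (hF.of_le (by exact_mod_cast j.le_succ)) hd'
      (fun k hk => by rw [← iteratedDeriv_succ']; exact hu _ (by lia))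
      (fun k hk => by rw [← iteratedDeriv_succ']; exact hv _ (by lia)), hparts, pow_succ]
    ring

/-- If a differential operator annihilates `F` on `[u, v]`, then `F` is orthogonal to the formal
adjoint applied to a smooth function `w` such that the derivatives of `w * q j` of order `< N`
vanish at both endpoints. -/
theorem integral_mul_sum_iteratedDeriv_eq_zero {u v : ℝ} (huv : u < v) (N : ℕ)
    (q : ℕ → ℝ → ℝ) {F w : ℝ → ℝ} (g : ℕ → ℝ → ℝ) (hgw : ∀ j x, g j x = q j x * w x)
    (hF : ContDiffOn ℝ N F (Set.Icc u v)) (hg : ∀ j, ContDiff ℝ (⊤ : ℕ∞) (g j))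
    (hu : ∀ j, ∀ k < N, iteratedDeriv k (g j) u = 0)
    (hv : ∀ j, ∀ k < N, iteratedDeriv k (g j) v = 0)
    (hode : ∀ x ∈ Set.Icc u v,
      ∑ j ∈ Finset.range (N + 1), q j x * iteratedDerivWithin j F (Set.Icc u v) x = 0) :
    ∫ x in u..v, F x * ∑ j ∈ Finset.range (N + 1), (-1 : ℝ) ^ j * iteratedDeriv j (g j) x = 0 := by
  have hFc : ContinuousOn F (Set.uIcc u v) := by
    rw [Set.uIcc_of_le huv.le]; exact hF.continuousOn
  have hterm : ∀ j ∈ Finset.range (N + 1),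
      ∫ x in u..v, F x * ((-1 : ℝ) ^ j * iteratedDeriv j (g j) x) =
        ∫ x in u..v, iteratedDerivWithin j F (Set.Icc u v) x * g j x := by
    intro j hj
    have hjN : j ≤ N := by simpa [Nat.lt_succ_iff] using hj
    simp_rw [mul_left_comm (F _)]
    rw [intervalIntegral.integral_const_mul, integral_mul_iteratedDeriv_of_vanishing huv j
      (hF.of_le (by exact_mod_cast hjN)) (hg j) (fun k hk => hu j k (by lia))
      (fun k hk => hv j k (by lia)), ← mul_assoc, ← mul_pow]
    simp
  simp_rw [Finset.mul_sum]
  rw [intervalIntegral.integral_finsetSum, Finset.sum_congr rfl hterm,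
    ← intervalIntegral.integral_finsetSum]
  · rw [intervalIntegral.integral_congr (g := fun _ => 0), intervalIntegral.integral_zero]
    intro x hx
    rw [Set.uIcc_of_le huv.le] at hx
    calc ∑ j ∈ Finset.range (N + 1), iteratedDerivWithin j F (Set.Icc u v) x * g j x
        = (∑ j ∈ Finset.range (N + 1), q j x * iteratedDerivWithin j F (Set.Icc u v) x) * w x := by
          rw [Finset.sum_mul]
          exact Finset.sum_congr rfl fun j _ => by rw [hgw]; ring
      _ = 0 := by rw [hode x hx, zero_mul]
  · intro j hj
    have hjN : j ≤ N := by simpa [Nat.lt_succ_iff] using hj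
    have hc := hF.continuousOn_iteratedDerivWithin (m := j) (by exact_mod_cast hjN)
      (uniqueDiffOn_Icc huv)
    refine ContinuousOn.intervalIntegrable ?_
    rw [Set.uIcc_of_le huv.le]
    exact hc.mul (hg j).continuous.continuousOn
  · intro j _
    exact (hFc.mul (continuous_const.mul ((hg j).continuous_iteratedDeriv j
      (by exact_mod_cast le_top))).continuousOn).intervalIntegrable

theorem piecewise_annihilated_as_distribution (a b : ℝ) (hab : a < b)
    (N : ℕ) (hN : 1 ≤ N) (P : ℕ → Polynomial ℝ)
    (p : ℕ) (ξ : ℕ → ℝ) (hξa : ξ 0 = a) (hξb : ξ (p + 1) = b)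
    (hξmono : ∀ n ≤ p, ξ n < ξ (n + 1))
    (f : ℝ → ℝ) (F : ℕ → ℝ → ℝ)
    (hcoin : ∀ n ≤ p, ∀ x ∈ Set.Ico (ξ n) (ξ (n + 1)), f x = F n x)
    (hF : ∀ n ≤ p, ContDiffOn ℝ (N : ℕ) (F n) (Set.Icc (ξ n) (ξ (n + 1))))
    (hode : ∀ n ≤ p, ∀ x ∈ Set.Icc (ξ n) (ξ (n + 1)),
      ∑ j ∈ Finset.range (N + 1),
        (P j).eval x * iteratedDerivWithin j (F n) (Set.Icc (ξ n) (ξ (n + 1))) x = 0) :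
    ∀ φ : ℝ → ℝ, ContDiff ℝ (⊤ : ℕ∞) φ → HasCompactSupport φ →
      tsupport φ ⊆ Set.Ioo a b →
      ∫ x in a..b, f x * ∑ j ∈ Finset.range (N + 1),
        (-1 : ℝ) ^ j *
          iteratedDeriv j
            (fun y => (∏ l ∈ Finset.Icc 1 p, (y - ξ l) ^ N) * (P j).eval y * φ y) x = 0 := by
  intro φ hφ _ hsupp
  set g : ℕ → ℝ → ℝ := fun j y => (∏ l ∈ Finset.Icc 1 p, (y - ξ l) ^ N) * (P j).eval y * φ y
    with hgdef
  have hP : ∀ j, ContDiff ℝ (⊤ : ℕ∞) fun y => (P j).eval y := fun j => by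
    simpa using (P j).contDiff_aeval (𝕜 := ℝ) (⊤ : ℕ∞)
  have hg : ∀ j, ContDiff ℝ (⊤ : ℕ∞) (g j) := fun j =>
    ((contDiff_prod fun l _ => (contDiff_id.sub contDiff_const).pow N).mul (hP j)).mul hφ
  have hout : ∀ c, c ∉ Set.Ioo a b → ∀ j k, iteratedDeriv k (g j) c = 0 := by
    intro c hc j k
    have hev : g j =ᶠ[nhds c] fun _ => 0 := by
      filter_upwards [notMem_tsupport_iff_eventuallyEq.mp fun h => hc (hsupp h)] with y hy
      simp [hgdef, hy]
    rw [hev.iteratedDeriv_eq]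
    simp
  have hvanish : ∀ n ≤ p + 1, ∀ j, ∀ k < N, iteratedDeriv k (g j) (ξ n) = 0 := by
    intro n hn j k hk
    rcases Nat.eq_zero_or_pos n with rfl | hpos
    · exact hout _ (by simp [hξa]) j k
    rcases hn.eq_or_lt with rfl | hlt
    · exact hout _ (by simp [hξb]) j k
    have hmem : n ∈ Finset.Icc 1 p := Finset.mem_Icc.mpr ⟨hpos, by lia⟩
    have hfac : g j = fun y => (y - ξ n) ^ N *
        ((∏ l ∈ (Finset.Icc 1 p).erase n, (y - ξ l) ^ N) * (P j).eval y * φ y) := by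
      funext y
      simp only [hgdef, ← Finset.mul_prod_erase _ _ hmem, mul_assoc]
    rw [hfac]
    exact iteratedDeriv_sub_pow_mul_eq_zero _ hk
      (((contDiff_prod fun l _ => (contDiff_id.sub contDiff_const).pow N).mul (hP j)).mul hφ)
  have hcongr : ∀ n ≤ p, Set.EqOn
      (fun x => F n x * ∑ j ∈ Finset.range (N + 1), (-1 : ℝ) ^ j * iteratedDeriv j (g j) x)
      (fun x => f x * ∑ j ∈ Finset.range (N + 1), (-1 : ℝ) ^ j * iteratedDeriv j (g j) x)
      (Set.uIoo (ξ n) (ξ (n + 1))) := by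
    intro n hn x hx
    rw [Set.uIoo_of_le (hξmono n hn).le] at hx
    simp only [hcoin n hn x (Set.Ioo_subset_Ico_self hx)]
  rw [← hξa, ← hξb, ← intervalIntegral.sum_integral_adjacent_intervals]
  · refine Finset.sum_eq_zero fun n hn => ?_
    have hnp : n ≤ p := by simpa [Nat.lt_succ_iff] using hn
    rw [← intervalIntegral.integral_congr_uIoo (hcongr n hnp)]
    exact integral_mul_sum_iteratedDeriv_eq_zero (hξmono n hnp) N (fun j x => (P j).eval x)
      (w := fun y => (∏ l ∈ Finset.Icc 1 p, (y - ξ l) ^ N) * φ y) g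
      (fun j x => by simp only [hgdef]; ring) (hF n hnp) hg
      (hvanish n (by lia)) (hvanish (n + 1) (by lia)) (hode n hnp)
  · intro n hn
    have hnp : n ≤ p := by lia
    refine IntervalIntegrable.congr_uIoo (ContinuousOn.intervalIntegrable ?_) (hcongr n hnp)
    rw [Set.uIcc_of_le (hξmono n hnp).le]
    exact (hF n hnp).continuousOn.mul (continuous_finsetSum _ fun j _ => continuous_const.mul
      ((hg j).continuous_iteratedDeriv j (by exact_mod_cast le_top))).continuousOn
end

section
/- Let α, β ∈ ℝ with α ≠ 0, and define m_k = α ∫_0^1 x^k e^{βx} dx for k ∈ ℕ. Then m_1 ≠ m_2, and β = (2 m_1 − m_0) / (m_1 − m_2). -/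
open intervalIntegral

theorem intervalIntegrable_pow_mul_exp (β : ℝ) (k : ℕ) (a b : ℝ) :
    IntervalIntegrable (fun x : ℝ => x ^ k * Real.exp (β * x)) MeasureTheory.volume a b :=
  Continuous.intervalIntegrable (by fun_prop) a b

theorem integral_sq_mul_exp_lt_integral_mul_exp (β : ℝ) :
    ∫ x in (0:ℝ)..1, x ^ 2 * Real.exp (β * x) < ∫ x in (0:ℝ)..1, x ^ 1 * Real.exp (β * x) := by
  rw [← sub_pos, ← integral_sub (intervalIntegrable_pow_mul_exp β 1 0 1)
    (intervalIntegrable_pow_mul_exp β 2 0 1)]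
  refine intervalIntegral_pos_of_pos_on ((intervalIntegrable_pow_mul_exp β 1 0 1).sub
    (intervalIntegrable_pow_mul_exp β 2 0 1)) (fun x hx => ?_) one_pos
  have h : 0 < x * (1 - x) * Real.exp (β * x) :=
    mul_pos (mul_pos hx.1 (sub_pos.2 hx.2)) (Real.exp_pos _)
  linear_combination h

/-- Integrating the derivative of `(x - x ^ 2) * exp (β * x)`, which vanishes at both endpoints. -/
theorem integral_exp_moments_relation (β : ℝ) :
    (∫ x in (0:ℝ)..1, x ^ 0 * Real.exp (β * x)) - 2 * (∫ x in (0:ℝ)..1, x ^ 1 * Real.exp (β * x))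
      + β * ((∫ x in (0:ℝ)..1, x ^ 1 * Real.exp (β * x))
        - ∫ x in (0:ℝ)..1, x ^ 2 * Real.exp (β * x)) = 0 := by
  have h0 := intervalIntegrable_pow_mul_exp β 0 0 1
  have h1 := intervalIntegrable_pow_mul_exp β 1 0 1
  have h2 := intervalIntegrable_pow_mul_exp β 2 0 1
  rw [← integral_sub h1 h2, ← integral_const_mul, ← integral_const_mul,
    ← integral_sub h0 (h1.const_mul 2),
    ← integral_add (h0.sub (h1.const_mul 2)) ((h1.sub h2).const_mul β),
    integral_eq_sub_of_hasDerivAt (f := fun x => (x - x ^ 2) * Real.exp (β * x))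
      (fun x _ => ?_) ((h0.sub (h1.const_mul 2)).add ((h1.sub h2).const_mul β))]
  · norm_num
  · have h : HasDerivAt (fun x : ℝ => (x - x ^ 2) * Real.exp (β * x)) _ x :=
      ((hasDerivAt_id' x).sub (hasDerivAt_pow 2 x)).mul ((hasDerivAt_id' x).const_mul β).exp
    refine h.congr_deriv ?_
    simp
    ring

theorem exponential_rate_from_moments (α β : ℝ) (hα : α ≠ 0) (m : ℕ → ℝ)
    (hm : ∀ k : ℕ, m k = α * ∫ x in (0:ℝ)..1, x ^ k * Real.exp (β * x)) :
    m 1 ≠ m 2 ∧ β = (2 * m 1 - m 0) / (m 1 - m 2) := by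
  have hne : m 1 ≠ m 2 := by
    rw [hm, hm]
    exact fun h => (integral_sq_mul_exp_lt_integral_mul_exp β).ne' (mul_left_cancel₀ hα h)
  refine ⟨hne, ?_⟩
  rw [eq_div_iff (sub_ne_zero.2 hne), hm, hm, hm]
  linear_combination α * integral_exp_moments_relation β
end

section
/- Let α, β ∈ ℝ with β ≠ 0, and define m_k = α ∫_0^1 x^k e^{βx} dx for k ∈ ℕ. Then for every k ∈ ℕ: m_k = ((−1)^k k! / β^k) · ( c_1 + c_2 Σ_{j=0}^{k−1} (−1)^{j−1} β^j / (j+1)! ), where c_1 = m_0 and c_2 = β m_1 + m_0. -/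
open intervalIntegral Finset

/-- Integration by parts for the moments of the exponential function on `[0, 1]`. -/
lemma integral_pow_succ_mul_exp_add (β : ℝ) (k : ℕ) :
    β * (∫ x in (0:ℝ)..1, x ^ (k + 1) * Real.exp (β * x)) +
      (k + 1) * (∫ x in (0:ℝ)..1, x ^ k * Real.exp (β * x)) = Real.exp β := by
  have hderiv : ∀ x ∈ Set.uIcc (0:ℝ) 1,
      HasDerivAt (fun x : ℝ => x ^ (k + 1) * Real.exp (β * x))
        (β * (x ^ (k + 1) * Real.exp (β * x)) + (k + 1) * (x ^ k * Real.exp (β * x))) x := by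
    intro x _
    have h := (hasDerivAt_pow (k + 1) x).mul ((hasDerivAt_id x).const_mul β).exp
    refine h.congr_deriv ?_
    simp only [id, Nat.add_sub_cancel]
    push_cast
    ring
  have hint (c : ℝ) (n : ℕ) : IntervalIntegrable
      (fun x : ℝ => c * (x ^ n * Real.exp (β * x))) MeasureTheory.volume 0 1 :=
    Continuous.intervalIntegrable (by fun_prop) _ _
  have h := integral_eq_sub_of_hasDerivAt hderiv ((hint β (k + 1)).add (hint (k + 1) k))
  rw [integral_add (hint β (k + 1)) (hint (k + 1) k), integral_const_mul,
    integral_const_mul] at h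
  simpa using h

theorem exponential_moments_explicit_formula (α β : ℝ) (hβ : β ≠ 0) (m : ℕ → ℝ)
    (hm : ∀ k : ℕ, m k = α * ∫ x in (0:ℝ)..1, x ^ k * Real.exp (β * x)) :
    ∀ k : ℕ,
      m k = ((-1 : ℝ) ^ k * (k.factorial : ℝ) / β ^ k) *
        (m 0 + (β * m 1 + m 0) *
          ∑ j ∈ Finset.range k, β ^ j * (-1 : ℝ) ^ (j + 1) / ((j + 1).factorial : ℝ)) := by
  have hrec (k : ℕ) : β * m (k + 1) + (k + 1) * m k = α * Real.exp β := by
    rw [hm, hm, ← integral_pow_succ_mul_exp_add β k]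
    ring
  have hc : β * m 1 + m 0 = α * Real.exp β := by simpa using hrec 0
  rw [hc]
  intro k
  induction k with
  | zero => simp
  | succ k ih =>
    have hstep : m (k + 1) = (α * Real.exp β - (k + 1) * m k) / β := by
      rw [eq_div_iff hβ]
      linarith [hrec k]
    have hsign : ((-1 : ℝ) ^ k) ^ 2 = 1 := by rw [← pow_mul, mul_comm, pow_mul]; simp
    rw [hstep, ih, Finset.sum_range_succ, Nat.factorial_succ]
    generalize (∑ j ∈ Finset.range k, β ^ j * (-1 : ℝ) ^ (j + 1) / ((j + 1).factorial : ℝ)) = S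
    push_cast
    rw [pow_succ (-1 : ℝ) k]
    generalize (-1 : ℝ) ^ k = s at *
    field_simp
    linear_combination (-(α * Real.exp β * β * β ^ (k * 2))) * hsign
end
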